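/- Let n, k, r, q ∈ ℕ with n ≥ k ≥ r ≥ q > 0 and n ≡ k (mod 2). Then μ(n,k,r,q) = (n−k)·μ(n−2,k,r,q) + μ(n−1,k−1,r−1,q−1) + μ(n−1,k−1,r−1,q) + (k−r)·μ(n−2,k−2,r−1,q) + (r−1)·μ(n−2,k−2,r−2,q), where μ(m,k,r,q) counts PB-pairs (η,X) on an m-set with |X| = q whose join with (ε_{m,k},{1,…,r}) has rank q (and μ = 0 when the parameters are inadmissible). -/

import Mathlib

/-- An equivalence is a 1-2-equivalence if every class has size at most 2. -/
def IsOneTwo {T : Type*} (ε : Setoid T) : Prop :=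
  ∀ x : T, ({y : T | ε.r x y}).ncard ≤ 2

/-- A PB-pair: a 1-2-equivalence together with a set of elements lying in
singleton classes. -/
def IsPBPair {T : Type*} (ε : Setoid T) (X : Set T) : Prop :=
  IsOneTwo ε ∧ ∀ x ∈ X, ∀ y : T, ε.r x y → y = x

/-- The rank of the join of two PB-pairs: the number of pairs `(x, y) ∈ X₁ × X₂`
lying in a common class of the join `ε₁ ⊔ ε₂` of the equivalences. -/
noncomputable def joinRank {T : Type*} (ε₁ : Setoid T) (X₁ : Set T)
    (ε₂ : Setoid T) (X₂ : Set T) : ℕ :=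
  {p : T × T | p.1 ∈ X₁ ∧ p.2 ∈ X₂ ∧ (ε₁ ⊔ ε₂).r p.1 p.2}.ncard

/-- The 1-2-equivalence `ε_{n,k}` on `{0,…,n-1}` with singleton classes
`{0},…,{k-1}` and doubleton classes `{k,k+1}, {k+2,k+3}, …`. -/
def epsNK (n k : ℕ) : Setoid (Fin n) where
  r x y := x = y ∨ (k ≤ x.val ∧ k ≤ y.val ∧ (x.val - k) / 2 = (y.val - k) / 2)
  iseqv := by
    constructor
    · exact fun x => Or.inl rfl
    · rintro x y (rfl | ⟨h1, h2, h3⟩)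
      · exact Or.inl rfl
      · exact Or.inr ⟨h2, h1, h3.symm⟩
    · rintro x y z (rfl | ⟨h1, h2, h3⟩) h
      · exact h
      · rcases h with rfl | ⟨h4, h5, h6⟩
        · exact Or.inr ⟨h1, h2, h3⟩
        · exact Or.inr ⟨h1, h5, h3.trans h6⟩

/-- The domain `[r] = {0,…,r-1}` inside `Fin n`. -/
def domSet (n r : ℕ) : Set (Fin n) := {x : Fin n | x.val < r}

/-- `mu n k r q` is the number of PB-pairs `(η, X)` on an `n`-set with `|X| = q`
whose join with `(ε_{n,k}, [r])` has rank `q`; it is `0` if `(ε_{n,k}, [r])` is not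
a well-defined PB-pair (i.e. unless `n ≥ k ≥ r` and `n ≡ k (mod 2)`). -/
noncomputable def mu (n k r q : ℕ) : ℕ :=
  if k ≤ n ∧ r ≤ k ∧ n % 2 = k % 2 then
    {p : Setoid (Fin n) × Set (Fin n) |
      IsPBPair p.1 p.2 ∧ p.2.ncard = q ∧
      joinRank (epsNK n k) (domSet n r) p.1 p.2 = q}.ncard
  else 0

/-- The set of PB-pairs counted by `mu`, for an arbitrary first PB-pair `(ε, D)`. -/
def fullRankPairs {T : Type*} (ε : Setoid T) (D : Set T) (q : ℕ) : Set (Setoid T × Set T) :=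
  {p | IsPBPair p.1 p.2 ∧ p.2.ncard = q ∧ joinRank ε D p.1 p.2 = q}

/-- The pairs `(η, X)` for which `{a, b}` is an `η`-class and `a ∉ X`. -/
def pairsMatching {T : Type*} (a b : T) : Set (Setoid T × Set T) :=
  {p | (∀ y, p.1.r a y ↔ y = a ∨ y = b) ∧ a ∉ p.2}

/-- Extend an equivalence along an injection, gluing the complement of the range
into one class. -/
def extendSetoid {T T' : Type*} (i : T' → T) (hi : Function.Injective i) (η : Setoid T') :
    Setoid T where
  r x y := (x ∉ Set.range i ∧ y ∉ Set.range i) ∨ ∃ x' y', i x' = x ∧ i y' = y ∧ η.r x' y'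
  iseqv := by
    constructor
    · intro x
      by_cases hx : x ∈ Set.range i
      · obtain ⟨x', rfl⟩ := hx
        exact Or.inr ⟨x', x', rfl, rfl, η.refl x'⟩
      · exact Or.inl ⟨hx, hx⟩
    · rintro x y (⟨h1, h2⟩ | ⟨x', y', h1, h2, h3⟩)
      · exact Or.inl ⟨h2, h1⟩
      · exact Or.inr ⟨y', x', h2, h1, η.symm h3⟩
    · rintro x y z (⟨h1, h2⟩ | ⟨x', y', rfl, rfl, h3⟩) (⟨h4, h5⟩ | ⟨y'', z', h4, rfl, h6⟩)
      · exact Or.inl ⟨h1, h5⟩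
      · exact absurd ⟨y'', h4⟩ h2
      · exact absurd ⟨y', rfl⟩ h4
      · obtain rfl := hi h4
        exact Or.inr ⟨x', z', rfl, rfl, η.trans h3 h6⟩

theorem extendSetoid_apply {T T' : Type*} {i : T' → T} (hi : Function.Injective i)
    (η : Setoid T') (x y : T') : (extendSetoid i hi η).r (i x) (i y) ↔ η.r x y := by
  constructor
  · rintro (⟨h, -⟩ | ⟨x', y', h1, h2, h⟩)
    · exact absurd ⟨x, rfl⟩ h
    · rwa [← hi h1, ← hi h2]
  · exact fun h => Or.inr ⟨x, y, rfl, rfl, h⟩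

section Restriction

variable {T T' : Type*} {i : T' → T} {a b : T} {p : Setoid T × Set T}

theorem subset_range_of_mem_pairsMatching (hr : Set.range i = {a, b}ᶜ)
    (hp : IsPBPair p.1 p.2) (hab : p ∈ pairsMatching a b) : p.2 ⊆ Set.range i := by
  intro x hx
  rw [hr]
  rintro (rfl | rfl)
  · exact hab.2 hx
  · have h := hp.2 x hx a (p.1.symm ((hab.1 x).2 (Or.inr rfl)))
    exact hab.2 (h ▸ hx)

theorem IsPBPair.comap [Finite T] (hi : Function.Injective i) (hp : IsPBPair p.1 p.2) :
    IsPBPair (Setoid.comap i p.1) (i ⁻¹' p.2) := by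
  refine ⟨fun x => ?_, fun x hx y hxy => hi (hp.2 _ hx _ hxy)⟩
  rw [← Set.ncard_image_of_injective _ hi]
  refine (Set.ncard_le_ncard ?_ (Set.toFinite _)).trans (hp.1 (i x))
  rintro _ ⟨y, hy, rfl⟩
  exact hy

theorem IsPBPair.extend [Finite T] (hi : Function.Injective i)
    (hr : Set.range i = {a, b}ᶜ) {η : Setoid T'} {X : Set T'} (hp : IsPBPair η X) :
    IsPBPair (extendSetoid i hi η) (i '' X) := by
  refine ⟨fun x => ?_, ?_⟩
  · by_cases hx : x ∈ Set.range i
    · obtain ⟨x, rfl⟩ := hx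
      have h : {y | (extendSetoid i hi η).r (i x) y} = i '' {y | η.r x y} := by
        ext y
        constructor
        · rintro (⟨h, -⟩ | ⟨x', y', h1, rfl, h⟩)
          · exact absurd ⟨x, rfl⟩ h
          · exact ⟨y', hi h1 ▸ h, rfl⟩
        · rintro ⟨y', h, rfl⟩
          exact (extendSetoid_apply hi η x y').2 h
      rw [h, Set.ncard_image_of_injective _ hi]
      exact hp.1 x
    · refine (Set.ncard_le_ncard (t := {a, b}) ?_ (Set.toFinite _)).trans ((Set.ncard_insert_le a {b}).trans (by simp))
      rintro y (⟨-, h⟩ | ⟨x', y', h1, -, -⟩)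
      · rwa [hr, Set.mem_compl_iff, not_not] at h
      · exact absurd ⟨x', h1⟩ hx
  · rintro _ ⟨x, hx, rfl⟩ y (⟨h, -⟩ | ⟨x', y', h1, rfl, h⟩)
    · exact absurd ⟨x, rfl⟩ h
    · rw [hp.2 x hx y' (hi h1 ▸ h)]

theorem extendSetoid_mem_pairsMatching (hi : Function.Injective i)
    (hr : Set.range i = {a, b}ᶜ) (η : Setoid T') (X : Set T') :
    (extendSetoid i hi η, i '' X) ∈ pairsMatching a b := by
  have ha : a ∉ Set.range i := by simp [hr]
  refine ⟨fun y => ⟨?_, fun h => ?_⟩, fun ⟨x, _, h⟩ => ha ⟨x, h⟩⟩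
  · rintro (⟨-, h⟩ | ⟨x', y', h1, -, -⟩)
    · rwa [hr, Set.mem_compl_iff, not_not] at h
    · exact absurd ⟨x', h1⟩ ha
  · refine Or.inl ⟨ha, ?_⟩
    rw [hr, Set.mem_compl_iff, not_not]
    exact h

theorem extendSetoid_comap (hi : Function.Injective i)
    (hr : Set.range i = {a, b}ᶜ) (hab : p ∈ pairsMatching a b) :
    extendSetoid i hi (Setoid.comap i p.1) = p.1 := by
  have key : ∀ x, x ∉ Set.range i ↔ p.1.r a x := fun x => by
    rw [hr, Set.mem_compl_iff, not_not]; exact (hab.1 x).symm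
  ext x y
  constructor
  · rintro (⟨h1, h2⟩ | ⟨x', y', rfl, rfl, h⟩)
    · exact p.1.trans (p.1.symm ((key x).1 h1)) ((key y).1 h2)
    · exact h
  · intro h
    by_cases hx : x ∈ Set.range i
    · by_cases hy : y ∈ Set.range i
      · obtain ⟨x, rfl⟩ := hx
        obtain ⟨y, rfl⟩ := hy
        exact Or.inr ⟨x, y, rfl, rfl, h⟩
      · exact absurd hx ((key x).2 (p.1.trans ((key y).1 hy) (p.1.symm h)))
    · exact Or.inl ⟨hx, (key y).2 (p.1.trans ((key x).1 hx) h)⟩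

theorem comap_extendSetoid (hi : Function.Injective i) (η : Setoid T') :
    Setoid.comap i (extendSetoid i hi η) = η := by
  ext x y
  exact extendSetoid_apply hi η x y

/-- Restriction identifies the full rank pairs in which `{a, b}` is a class with the full rank
pairs on the complement of `{a, b}`. -/
theorem ncard_fullRankPairs_inter_pairsMatching [Finite T]
    (hi : Function.Injective i) (hr : Set.range i = {a, b}ᶜ)
    {ε : Setoid T} {D : Set T} {ε' : Setoid T'} {D' : Set T'} (q : ℕ)
    (hrank : ∀ p : Setoid T × Set T, IsPBPair p.1 p.2 → p ∈ pairsMatching a b →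
      joinRank ε D p.1 p.2 = joinRank ε' D' (Setoid.comap i p.1) (i ⁻¹' p.2)) :
    (fullRankPairs ε D q ∩ pairsMatching a b).ncard = (fullRankPairs ε' D' q).ncard := by
  refine Set.ncard_congr (fun p _ => (Setoid.comap i p.1, i ⁻¹' p.2)) ?_ ?_ ?_
  · rintro p ⟨⟨h1, h2, h3⟩, hab⟩
    refine ⟨h1.comap hi, ?_, (hrank p h1 hab).symm.trans h3⟩
    rw [← h2, Set.ncard_preimage_of_injective_subset_range hi
      (subset_range_of_mem_pairsMatching hr h1 hab)]
  · rintro p p' ⟨⟨h1, -, -⟩, hab⟩ ⟨⟨h1', -, -⟩, hab'⟩ h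
    have h2 := congrArg Prod.fst h
    have h3 := congrArg Prod.snd h
    simp only at h2 h3
    refine Prod.ext ?_ ?_
    · rw [← extendSetoid_comap hi hr hab, h2, extendSetoid_comap hi hr hab']
    · rw [← Set.image_preimage_eq_of_subset (subset_range_of_mem_pairsMatching hr h1 hab), h3,
        Set.image_preimage_eq_of_subset (subset_range_of_mem_pairsMatching hr h1' hab')]
  · rintro ⟨η, X⟩ ⟨h1, h2, h3⟩
    have hm := extendSetoid_mem_pairsMatching hi hr η X
    have h4 := h1.extend hi hr
    have h5 : (Setoid.comap i (extendSetoid i hi η), i ⁻¹' (i '' X)) = (η, X) := by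
      rw [comap_extendSetoid, Set.preimage_image_eq _ hi]
    refine ⟨(extendSetoid i hi η, i '' X), ⟨⟨h4, ?_, ?_⟩, hm⟩, h5⟩
    · exact (Set.ncard_image_of_injective _ hi).trans h2
    · rw [hrank _ h4 hm]
      simp only [Prod.mk.injEq] at h5
      simp only [h5.1, h5.2]
      exact h3

end Restriction

section JoinRank

variable {T T' : Type*} {i : T' → T} {a b : T} {p : Setoid T × Set T}

theorem Setoid.comap_sup_comap_le (i : T' → T) (ε η : Setoid T) :
    Setoid.comap i ε ⊔ Setoid.comap i η ≤ Setoid.comap i (ε ⊔ η) :=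
  sup_le (fun _ _ h => (le_sup_left : ε ≤ ε ⊔ η) h) (fun _ _ h => (le_sup_right : η ≤ ε ⊔ η) h)

/-- If `{a, b}` is also a union of `ε`-classes, it can be removed without changing the rank. -/
theorem joinRank_restrict_of_closed (hi : Function.Injective i)
    (hr : Set.range i = {a, b}ᶜ) {ε : Setoid T} (D : Set T)
    (ha : ∀ y, ε.r a y → y = a) (hb : ∀ y, ε.r b y → y = b)
    (hp : IsPBPair p.1 p.2) (hab : p ∈ pairsMatching a b) :
    joinRank ε D p.1 p.2 =
      joinRank (Setoid.comap i ε) (i ⁻¹' D) (Setoid.comap i p.1) (i ⁻¹' p.2) := by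
  obtain ⟨η, X⟩ := p
  have hX := subset_range_of_mem_pairsMatching hr hp hab
  have hmem : ∀ x, x ∉ Set.range i ↔ x = a ∨ x = b := fun x => by
    rw [hr, Set.mem_compl_iff, not_not]; rfl
  have ext_of : ∀ (σ : Setoid T) (J : Setoid T'), Setoid.comap i σ ≤ J →
      (∀ x y, σ.r x y → x ∉ Set.range i → y ∉ Set.range i) → σ ≤ extendSetoid i hi J := by
    intro σ J hJ hσ x y h
    by_cases hx : x ∈ Set.range i
    · by_cases hy : y ∈ Set.range i
      · obtain ⟨x, rfl⟩ := hx
        obtain ⟨y, rfl⟩ := hy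
        exact Or.inr ⟨x, y, rfl, rfl, hJ h⟩
      · exact absurd hx (hσ y x (σ.symm h) hy)
    · exact Or.inl ⟨hx, hσ x y h hx⟩
  have hle : ε ⊔ η ≤ extendSetoid i hi (Setoid.comap i ε ⊔ Setoid.comap i η) := by
    refine sup_le (ext_of _ _ le_sup_left ?_) (ext_of _ _ le_sup_right ?_)
    · intro x y h hx
      rcases (hmem x).1 hx with rfl | rfl
      · rwa [ha y h]
      · rwa [hb y h]
    · intro x y h hx
      exact (hmem y).2 ((hab.1 y).1 (η.trans ((hab.1 x).2 ((hmem x).1 hx)) h))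
  unfold joinRank
  rw [← Set.ncard_image_of_injective _ (hi.prodMap hi)]
  congr 1
  ext ⟨d, x⟩
  constructor
  · rintro ⟨hd, hx, h⟩
    obtain ⟨x, rfl⟩ := hX hx
    rcases hle h with ⟨-, h'⟩ | ⟨d', x', h1, h2, h'⟩
    · exact absurd ⟨x, rfl⟩ h'
    · exact ⟨(d', x'), ⟨by simpa [h1] using hd, by simpa [h2] using hx, h'⟩, by simp [h1, h2]⟩
  · rintro ⟨⟨d', x'⟩, ⟨hd, hx, h⟩, h'⟩
    simp only [Prod.map, Prod.mk.injEq] at h'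
    obtain ⟨rfl, rfl⟩ := h'
    exact ⟨hd, hx, Setoid.comap_sup_comap_le i ε η h⟩

/-- If `a ∈ D` is joined by `η` to `b`, and `{b, c}` is an `ε`-class, then removing `a` and `b`
and letting `c` take the role of `a` does not change the rank. -/
theorem joinRank_restrict_of_contract (hi : Function.Injective i)
    (hr : Set.range i = {a, b}ᶜ) {ε : Setoid T} {D : Set T}
    (hD : ∀ d ∈ D, ∀ y, ε.r d y → y = d) (haD : a ∈ D) {c' : T'}
    (hbc : ∀ y, ε.r b y ↔ y = b ∨ y = i c')
    (hp : IsPBPair p.1 p.2) (hab : p ∈ pairsMatching a b) :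
    joinRank ε D p.1 p.2 =
      joinRank (Setoid.comap i ε) (insert c' (i ⁻¹' D)) (Setoid.comap i p.1) (i ⁻¹' p.2) := by
  classical
  obtain ⟨η, X⟩ := p
  have hX := subset_range_of_mem_pairsMatching hr hp hab
  have hmem : ∀ x, x ∉ Set.range i ↔ x = a ∨ x = b := fun x => by
    rw [hr, Set.mem_compl_iff, not_not]; rfl
  have hc_ne : i c' ≠ b := fun h => (hmem b).2 (Or.inr rfl) ⟨c', h⟩
  have hbD : b ∉ D := fun h => hc_ne (hD b h _ ((hbc _).2 (Or.inr rfl)))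
  have hcD : i c' ∉ D := fun h =>
    hc_ne (hD _ h b (ε.symm ((hbc _).2 (Or.inr rfl)))).symm
  let ρ : T → T' := Function.extend i id (fun _ => c')
  have hρ : ∀ x, ρ (i x) = x := fun x => hi.extend_apply _ _ x
  have hρ' : ∀ x, x ∉ Set.range i → ρ x = c' := fun x hx => Function.extend_apply' _ _ _ hx
  have le_of : ∀ (σ : Setoid T) (J : Setoid T'), Setoid.comap i σ ≤ J →
      (∀ x y, σ.r x y → x ∉ Set.range i → ρ y = c') → σ ≤ Setoid.comap ρ J := by
    intro σ J hJ hσ x y h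
    change J.r (ρ x) (ρ y)
    by_cases hx : x ∈ Set.range i
    · by_cases hy : y ∈ Set.range i
      · obtain ⟨x, rfl⟩ := hx
        obtain ⟨y, rfl⟩ := hy
        rw [hρ, hρ]
        exact hJ h
      · rw [hρ' y hy, hσ y x (σ.symm h) hy]
    · rw [hρ' x hx, hσ x y h hx]
  have hle : ε ⊔ η ≤ Setoid.comap ρ (Setoid.comap i ε ⊔ Setoid.comap i η) := by
    refine sup_le (le_of _ _ le_sup_left ?_) (le_of _ _ le_sup_right ?_)
    · intro x y h hx
      rcases (hmem x).1 hx with rfl | rfl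
      · rw [hD _ haD y h, hρ' _ hx]
      · rcases (hbc y).1 h with rfl | rfl
        · exact hρ' _ hx
        · exact hρ _
    · intro x y h hx
      exact hρ' _ ((hmem y).2 ((hab.1 y).1 (η.trans ((hab.1 x).2 ((hmem x).1 hx)) h)))
  have hac : (ε ⊔ η).r a (i c') :=
    (ε ⊔ η).trans ((le_sup_right : η ≤ ε ⊔ η) ((hab.1 b).2 (Or.inr rfl)))
      ((le_sup_left : ε ≤ ε ⊔ η) ((hbc _).2 (Or.inr rfl)))
  have ha : ∀ x, i x ≠ a := fun x h => (hmem a).2 (Or.inl rfl) ⟨x, h⟩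
  let ψ : T' → T := fun d => if d = c' then a else i d
  have hψ : Function.Injective ψ := by
    intro d e h
    simp only [ψ] at h
    split_ifs at h with h1 h2 h2
    · rw [h1, h2]
    · exact absurd h.symm (ha e)
    · exact absurd h (ha d)
    · exact hi h
  unfold joinRank
  rw [← Set.ncard_image_of_injective _ (hψ.prodMap hi)]
  congr 1
  ext ⟨d, x⟩
  constructor
  · rintro ⟨hd, hx, h⟩
    obtain ⟨x, rfl⟩ := hX hx
    have h' := hle h
    change (Setoid.comap i ε ⊔ Setoid.comap i η).r (ρ d) (ρ (i x)) at h'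
    rw [hρ] at h'
    by_cases hda : d = a
    · subst hda
      rw [hρ' _ ((hmem d).2 (Or.inl rfl))] at h'
      exact ⟨(c', x), ⟨Or.inl rfl, hx, h'⟩, by simp [ψ]⟩
    · have hdr : d ∈ Set.range i := by
        by_contra hdr
        rcases (hmem d).1 hdr with rfl | rfl
        · exact hda rfl
        · exact hbD hd
      obtain ⟨d, rfl⟩ := hdr
      rw [hρ] at h'
      have hdc : d ≠ c' := fun h => hcD (h ▸ hd)
      exact ⟨(d, x), ⟨Or.inr hd, hx, h'⟩, by simp [ψ, hdc]⟩
  · rintro ⟨⟨d', x'⟩, ⟨hd, hx, h⟩, h'⟩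
    simp only [Prod.map, Prod.mk.injEq] at h'
    obtain ⟨rfl, rfl⟩ := h'
    have h2 := Setoid.comap_sup_comap_le i ε η h
    by_cases hdc : d' = c'
    · subst hdc
      simp only [ψ, if_true]
      exact ⟨haD, hx, (ε ⊔ η).trans hac h2⟩
    · simp only [ψ, if_neg hdc]
      exact ⟨hd.resolve_left hdc, hx, h2⟩

/-- A point that is a singleton for both equivalences contributes exactly `1` to the rank. -/
theorem joinRank_insert_of_isolated [Finite T] {ε η : Setoid T} {D X : Set T} (haD : a ∈ D)
    (haX : a ∉ X) (hε : ∀ y, ε.r a y → y = a) (hη : ∀ y, η.r a y → y = a) :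
    joinRank ε D η (insert a X) = joinRank ε D η X + 1 := by
  have hle : ε ⊔ η ≤ Setoid.ker (fun x => x = a) := by
    have key : ∀ σ : Setoid T, (∀ y, σ.r a y → y = a) → σ ≤ Setoid.ker (fun x => x = a) := by
      intro σ hσ x y h
      change (x = a) = (y = a)
      refine propext ⟨?_, ?_⟩
      · rintro rfl
        exact hσ y h
      · rintro rfl
        exact hσ x (σ.symm h)
    exact sup_le (key ε hε) (key η hη)
  unfold joinRank
  have h : {p : T × T | p.1 ∈ D ∧ p.2 ∈ insert a X ∧ (ε ⊔ η).r p.1 p.2} =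
      insert (a, a) {p : T × T | p.1 ∈ D ∧ p.2 ∈ X ∧ (ε ⊔ η).r p.1 p.2} := by
    ext ⟨d, x⟩
    constructor
    · rintro ⟨hd, rfl | hx, h⟩
      · have h' : (d = x) = (x = x) := hle h
        simp only [eq_iff_iff, iff_true] at h'
        exact Or.inl (by rw [h'])
      · exact Or.inr ⟨hd, hx, h⟩
    · rintro (h | ⟨hd, hx, h⟩)
      · simp only [Prod.mk.injEq] at h
        obtain ⟨rfl, rfl⟩ := h
        exact ⟨haD, Or.inl rfl, (ε ⊔ η).refl _⟩
      · exact ⟨hd, Or.inr hx, h⟩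
  rw [h, Set.ncard_insert_of_notMem (fun h => haX h.2.1) (Set.toFinite _)]

end JoinRank

section Partition

variable {T : Type*} {ε : Setoid T} {D : Set T} {a : T}

/-- Deleting `a` from `X`. -/
theorem ncard_fullRankPairs_mem [Finite T] (haD : a ∈ D) (ha : ∀ y, ε.r a y → y = a) {q : ℕ} (hq : 0 < q) :
    (fullRankPairs ε D q ∩ {p | a ∈ p.2}).ncard =
      (fullRankPairs ε D (q - 1) ∩ pairsMatching a a).ncard := by
  symm
  refine Set.ncard_congr (fun p _ => (p.1, insert a p.2)) ?_ ?_ ?_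
  · rintro ⟨η, X⟩ ⟨⟨h1, h2, h3⟩, hm, haX⟩
    change a ∉ X at haX
    have hη : ∀ y, η.r a y → y = a := fun y h => by simpa using (hm y).1 h
    refine ⟨⟨⟨h1.1, ?_⟩, ?_, ?_⟩, Or.inl rfl⟩
    · rintro x (rfl | hx)
      · exact hη
      · exact h1.2 x hx
    · have := Set.ncard_insert_of_notMem haX (Set.toFinite _)
      change X.ncard = q - 1 at h2
      change (insert a X).ncard = q
      omega
    · have := joinRank_insert_of_isolated haD haX ha hη
      change joinRank ε D η X = q - 1 at h3
      change joinRank ε D η (insert a X) = q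
      omega
  · rintro ⟨η, X⟩ ⟨η', X'⟩ ⟨-, -, haX⟩ ⟨-, -, haX'⟩ h
    simp only [Prod.mk.injEq] at h haX haX' ⊢
    refine ⟨h.1, ?_⟩
    rw [← Set.insert_sdiff_self_of_notMem haX, h.2, Set.insert_sdiff_self_of_notMem haX']
  · rintro ⟨η, X⟩ ⟨⟨h1, h2, h3⟩, haX⟩
    simp only [Set.mem_ofPred_eq] at h1 h2 h3 haX
    have hX : insert a (X \ {a}) = X := by simp [Set.insert_eq_of_mem haX]
    have haX' : a ∉ X \ {a} := by simp
    have hη : ∀ y, η.r a y → y = a := h1.2 a haX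
    refine ⟨(η, X \ {a}), ⟨⟨⟨h1.1, fun x hx => h1.2 x hx.1⟩, ?_, ?_⟩, ?_, haX'⟩,
      by simp only [hX]⟩
    · have := Set.ncard_insert_of_notMem haX' (Set.toFinite _)
      rw [hX] at this
      change (X \ {a}).ncard = q - 1
      omega
    · have := joinRank_insert_of_isolated haD haX' ha hη
      rw [hX] at this
      change joinRank ε D η (X \ {a}) = q - 1
      omega
    · intro y
      simp only [or_self]
      exact ⟨hη y, fun h => h ▸ η.refl y⟩

/-- Classify the full rank pairs according to the `η`-class of `a`. -/
theorem ncard_fullRankPairs_eq_sum [Fintype T] (haD : a ∈ D) (ha : ∀ y, ε.r a y → y = a)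
    {q : ℕ} (hq : 0 < q) :
    (fullRankPairs ε D q).ncard =
      (fullRankPairs ε D (q - 1) ∩ pairsMatching a a).ncard +
        ∑ b : T, (fullRankPairs ε D q ∩ pairsMatching a b).ncard := by
  classical
  have : Finite (Setoid T) := Finite.of_injective (fun s : Setoid T => s.r)
    (fun s t h => Setoid.ext fun x y => by rw [show s.r = t.r from h])
  rw [← ncard_fullRankPairs_mem haD ha hq, ← Set.ncard_inter_add_ncard_sdiff_eq_ncard
    (fullRankPairs ε D q) {p | a ∈ p.2}]
  congr 1
  have hdiff : fullRankPairs ε D q \ {p | a ∈ p.2} =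
      ⋃ b : T, (fullRankPairs ε D q ∩ pairsMatching a b) := by
    ext ⟨η, X⟩
    simp only [Set.mem_sdiff, Set.mem_iUnion, Set.mem_inter_iff, Set.mem_ofPred_eq,
      exists_and_left]
    refine and_congr_right fun h => ⟨fun haX => ?_, fun ⟨b, hb⟩ => hb.2⟩
    by_cases hs : ∃ b, b ≠ a ∧ η.r a b
    · obtain ⟨b, hba, hb⟩ := hs
      refine ⟨b, fun y => ⟨fun hy => ?_, ?_⟩, haX⟩
      · by_contra! hne
        have h3 : ({y, a, b} : Set T).ncard = 3 :=
          Set.ncard_eq_three.2 ⟨y, a, b, hne.1, hne.2, hba.symm, rfl⟩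
        have h2 : ({y, a, b} : Set T) ⊆ {z | η.r a z} := by
          rintro z (rfl | rfl | rfl)
          exacts [hy, η.refl _, hb]
        have h4 := Set.ncard_le_ncard h2 (Set.toFinite _)
        have h5 : {z | η.r a z}.ncard ≤ 2 := h.1.1 a
        omega
      · rintro (rfl | rfl)
        exacts [η.refl _, hb]
    · push Not at hs
      refine ⟨a, fun y => ?_, haX⟩
      simp only [or_self]
      refine ⟨fun hy => by_contra fun hya => hs y hya hy, ?_⟩
      rintro rfl
      exact η.refl _
  rw [hdiff, Set.ncard_iUnion_of_finite (fun _ => Set.toFinite _), finsum_eq_sum_of_fintype]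
  intro b b' hbb
  refine Set.disjoint_left.2 ?_
  rintro ⟨η, X⟩ ⟨-, h, -⟩ ⟨-, h', -⟩
  apply hbb
  have h1 := (h' b).1 ((h b).2 (Or.inr rfl))
  have h2 := (h b').1 ((h' b').2 (Or.inr rfl))
  grind

end Partition

section StandardForm

theorem exists_equiv_prod_of_ncard_eq_two {N : Type*} [Finite N] (s : Setoid N)
    (h : ∀ x, {y | s.r x y}.ncard = 2) :
    ∃ m, ∃ e : N ≃ Fin m × Fin 2, ∀ x y, s.r x y ↔ (e x).1 = (e y).1 := by
  have F : ∀ c : Quotient s, Nonempty ({x // Quotient.mk s x = c} ≃ Fin 2) := by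
    intro c
    induction c using Quotient.inductionOn with | _ x =>
    refine ⟨Finite.equivFinOfCardEq ?_⟩
    rw [← h x]
    refine Nat.card_congr (Equiv.subtypeEquivRight fun y => ?_)
    rw [Quotient.eq]
    exact ⟨fun h => s.symm h, fun h => s.symm h⟩
  let eQ := Finite.equivFin (Quotient s)
  refine ⟨_, (Equiv.sigmaFiberEquiv (Quotient.mk s)).symm.trans
    ((Equiv.sigmaCongrRight fun c => (F c).some).trans
      ((Equiv.sigmaEquivProd _ _).trans (eQ.prodCongr (Equiv.refl _)))), fun x y => ?_⟩
  change _ ↔ eQ (Quotient.mk s x) = eQ (Quotient.mk s y)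
  rw [eQ.injective.eq_iff, Quotient.eq]

/-- Every 1-2-equivalence on a finite set `U` with singleton classes `Z` and a marked set `D ⊆ Z`
is isomorphic to `epsNK n k` with marked set `domSet n r`. -/
theorem exists_embedding_epsNK {T : Type*} [Finite T] (ε : Setoid T) {D Z U : Set T}
    {n k r : ℕ} (hDZ : D ⊆ Z) (hZU : Z ⊆ U) (hZ : ∀ x ∈ Z, ∀ y ∈ U, ε.r x y → y = x)
    (hN : ∀ x ∈ U \ Z, ∃ c ∈ U, c ≠ x ∧ ∀ y ∈ U, ε.r x y ↔ y = x ∨ y = c)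
    (hn : U.ncard = n) (hk : Z.ncard = k) (hr : D.ncard = r) :
    ∃ i : Fin n → T, Function.Injective i ∧ Set.range i = U ∧
      Setoid.comap i ε = epsNK n k ∧ i ⁻¹' D = domSet n r := by
  obtain ⟨m, e, he⟩ := exists_equiv_prod_of_ncard_eq_two
    (Setoid.comap (Subtype.val : ↥(U \ Z) → T) ε) (by
      rintro ⟨x, hx⟩
      obtain ⟨c, hc, hcx, h⟩ := hN x hx
      have hcZ : c ∉ Z := fun hcZ =>
        hcx (hZ c hcZ x hx.1 (ε.symm ((h c hc).2 (Or.inr rfl)))).symm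
      refine Set.ncard_eq_two.2 ⟨⟨x, hx⟩, ⟨c, hc, hcZ⟩, fun h => hcx (congrArg Subtype.val h).symm, ?_⟩
      ext ⟨y, hy⟩
      simp only [Set.mem_insert_iff, Set.mem_singleton_iff, Subtype.ext_iff]
      exact h y hy.1)
  have hm : n = k + 2 * m := by
    have h1 : (U \ Z).ncard = m * 2 := by
      rw [← Nat.card_coe_set_eq, Nat.card_congr e]
      simp
    have h2 := Set.ncard_sdiff_add_ncard_of_subset hZU (Set.toFinite _)
    omega
  have hrk : r ≤ k := by
    rw [← hr, ← hk]
    exact Set.ncard_le_ncard hDZ (Set.toFinite _)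
  let f : D ≃ Fin r := Finite.equivFinOfCardEq ((Nat.card_coe_set_eq D).trans hr)
  let g : ↥(Z \ D) ≃ Fin (k - r) := Finite.equivFinOfCardEq (by
    have h2 := Set.ncard_sdiff_add_ncard_of_subset hDZ (Set.toFinite _)
    rw [Nat.card_coe_set_eq]
    omega)
  let i : Fin n → T := fun x =>
    if h : x.val < r then f.symm ⟨x, h⟩
    else if h' : x.val < k then g.symm ⟨x - r, by omega⟩
    else e.symm (⟨(x - k) / 2, by omega⟩, ⟨(x - k) % 2, by omega⟩)
  have i1 : ∀ (x : Fin n) (h : x.val < r), i x = f.symm ⟨x, h⟩ := fun x h => by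
    simp only [i, dif_pos h]
  have i2 : ∀ (x : Fin n) (h : ¬ x.val < r) (h' : x.val < k),
      i x = g.symm ⟨x - r, by omega⟩ := fun x h h' => by
    simp only [i, dif_neg h, dif_pos h']
  have i3 : ∀ (x : Fin n) (h : k ≤ x.val),
      i x = e.symm (⟨(x - k) / 2, by omega⟩, ⟨(x - k) % 2, by omega⟩) := fun x h => by
    have h1 : ¬ x.val < r := by omega
    have h2 : ¬ x.val < k := by omega
    simp only [i, dif_neg h1, dif_neg h2]
  have hD : ∀ x : Fin n, i x ∈ D ↔ x.val < r := by
    intro x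
    by_cases h1 : x.val < r
    · simp only [h1, i1 x h1, Subtype.coe_prop]
    · by_cases h2 : x.val < k
      · rw [i2 x h1 h2]
        simp only [h1, iff_false]
        exact (g.symm _).2.2
      · rw [i3 x (by omega)]
        simp only [h1, iff_false]
        exact fun h => (e.symm _).2.2 (hDZ h)
  have hZk : ∀ x : Fin n, i x ∈ Z ↔ x.val < k := by
    intro x
    by_cases h1 : x.val < r
    · exact iff_of_true (hDZ ((hD x).2 h1)) (by omega)
    · by_cases h2 : x.val < k
      · rw [i2 x h1 h2]
        exact iff_of_true (g.symm _).2.1 h2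
      · rw [i3 x (by omega)]
        exact iff_of_false (e.symm _).2.2 h2
  have hU : ∀ x : Fin n, i x ∈ U := by
    intro x
    by_cases h2 : x.val < k
    · exact hZU ((hZk x).2 h2)
    · rw [i3 x (by omega)]
      exact (e.symm _).2.1
  have hinj : Function.Injective i := by
    intro x y h
    have hd := hD x
    have hz := hZk x
    rw [h, hD y] at hd
    rw [h, hZk y] at hz
    by_cases h1 : x.val < r
    · rw [i1 x h1, i1 y (hd.2 h1)] at h
      simpa [Fin.ext_iff] using f.symm.injective (Subtype.ext h)
    · by_cases h2 : x.val < k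
      · rw [i2 x h1 h2, i2 y (fun h' => h1 (hd.1 h')) (hz.2 h2)] at h
        have h3 := g.symm.injective (Subtype.ext h)
        simp only [Fin.mk.injEq] at h3
        ext
        omega
      · rw [i3 x (by omega), i3 y (by omega)] at h
        have h3 := e.symm.injective (Subtype.ext h)
        simp only [Prod.mk.injEq, Fin.mk.injEq] at h3
        ext
        omega
  refine ⟨i, hinj, ?_, ?_, Set.ext hD⟩
  · refine Set.eq_of_subset_of_ncard_le ?_ ?_ (Set.toFinite _)
    · rintro _ ⟨x, rfl⟩
      exact hU x
    · rw [hn, ← Set.image_univ, Set.ncard_image_of_injective _ hinj, Set.ncard_univ,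
        Nat.card_eq_fintype_card, Fintype.card_fin]
  · ext x y
    change ε.r (i x) (i y) ↔ x = y ∨ (k ≤ x.val ∧ k ≤ y.val ∧ (x.val - k) / 2 = (y.val - k) / 2)
    constructor
    · intro h
      by_cases hx : x.val < k
      · exact Or.inl (hinj (hZ _ ((hZk x).2 hx) _ (hU y) h)).symm
      · by_cases hy : y.val < k
        · exact Or.inl (hinj (hZ _ ((hZk y).2 hy) _ (hU x) (ε.symm h)))
        · refine Or.inr ⟨by omega, by omega, ?_⟩
          rw [i3 x (by omega), i3 y (by omega)] at h
          simpa using (he _ _).1 h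
    · rintro (rfl | ⟨hx, hy, h⟩)
      · exact ε.refl _
      · rw [i3 x hx, i3 y hy]
        exact (he _ _).2 (by simpa using h)

end StandardForm

section EpsNK

theorem epsNK_apply_of_lt {n k : ℕ} {x y : Fin n} (hx : x.val < k) (h : (epsNK n k).r x y) :
    y = x := by
  rcases h with h | h
  · exact h.symm
  · omega

theorem exists_partner_epsNK {n k : ℕ} (hpar : n % 2 = k % 2) {x : Fin n} (hx : k ≤ x.val) :
    ∃ c : Fin n, k ≤ c.val ∧ c ≠ x ∧ ∀ y, (epsNK n k).r x y ↔ y = x ∨ y = c := by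
  rcases Nat.mod_two_eq_zero_or_one (x.val - k) with h | h
  · refine ⟨⟨x + 1, by omega⟩, by simp only; omega, by simp [Fin.ext_iff], fun y => ?_⟩
    change x = y ∨ (k ≤ x.val ∧ k ≤ y.val ∧ (x.val - k) / 2 = (y.val - k) / 2) ↔ _
    simp only [Fin.ext_iff]
    omega
  · refine ⟨⟨x - 1, by omega⟩, by simp only; omega, by simp only [ne_eq, Fin.ext_iff]; omega,
      fun y => ?_⟩
    change x = y ∨ (k ≤ x.val ∧ k ≤ y.val ∧ (x.val - k) / 2 = (y.val - k) / 2) ↔ _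
    simp only [Fin.ext_iff]
    omega

theorem ncard_setOf_val_lt {n k : ℕ} (h : k ≤ n) : {x : Fin n | x.val < k}.ncard = k := by
  rw [← Nat.card_coe_set_eq, Nat.card_eq_fintype_card]
  simp [Fintype.card_subtype, Fin.card_filter_val_lt, h]

variable {n k r : ℕ}

theorem mu_eq_ncard_fullRankPairs {q : ℕ} (hkn : k ≤ n) (hrk : r ≤ k) (hpar : n % 2 = k % 2) :
    mu n k r q = (fullRankPairs (epsNK n k) (domSet n r) q).ncard :=
  if_pos ⟨hkn, hrk, hpar⟩

/-- Removing a set `{a, b}` of singleton `ε`-classes. -/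
theorem ncard_inter_pairsMatching_of_lt {k' n' r' : ℕ} (q : ℕ) (hrk : r ≤ k) (hkn : k ≤ n)
    (hpar : n % 2 = k % 2) {a b : Fin n} (ha : a.val < k) (hb : b.val < k)
    (hn' : n' + ({a, b} : Set (Fin n)).ncard = n)
    (hk' : k' + ({a, b} : Set (Fin n)).ncard = k)
    (hr' : (domSet n r \ {a, b}).ncard = r') :
    (fullRankPairs (epsNK n k) (domSet n r) q ∩ pairsMatching a b).ncard = mu n' k' r' q := by
  have hsub : ({a, b} : Set (Fin n)) ⊆ {x | x.val < k} := by
    rintro x (rfl | rfl)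
    exacts [ha, hb]
  have hZ := Set.ncard_sdiff_add_ncard_of_subset hsub (Set.toFinite _)
  rw [ncard_setOf_val_lt hkn] at hZ
  have hU := Set.ncard_add_ncard_compl ({a, b} : Set (Fin n)) (Set.toFinite _) (Set.toFinite _)
  rw [Nat.card_eq_fintype_card, Fintype.card_fin] at hU
  have hDZ : domSet n r \ {a, b} ⊆ {x : Fin n | x.val < k} \ {a, b} :=
    Set.sdiff_subset_sdiff_left fun x (hx : x.val < r) => (by omega : x.val < k)
  obtain ⟨i, hi, hr, hε, hD⟩ := exists_embedding_epsNK (epsNK n k) (U := {a, b}ᶜ)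
    (Z := {x | x.val < k} \ {a, b}) (n := n') (k := k') hDZ (fun x hx => hx.2)
    (fun x hx y _ h => epsNK_apply_of_lt hx.1 h)
    (by
      rintro x ⟨hxU, hxZ⟩
      have hxk : k ≤ x.val := by
        by_contra hxk
        exact hxZ ⟨not_le.1 hxk, hxU⟩
      obtain ⟨c, hck, hcx, hc⟩ := exists_partner_epsNK hpar hxk
      refine ⟨c, fun h => ?_, hcx, fun y _ => hc y⟩
      have : c.val < k := hsub h
      omega)
    (by omega) (by omega) hr'
  have hpre : i ⁻¹' domSet n r = domSet n' r' := by
    rw [← hD]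
    ext x
    refine ⟨fun h => ⟨h, ?_⟩, fun h => h.1⟩
    have : i x ∈ Set.range i := ⟨x, rfl⟩
    rwa [hr] at this
  have hrk' : r' ≤ k' := by
    have := Set.ncard_le_ncard hDZ (Set.toFinite _)
    omega
  rw [mu_eq_ncard_fullRankPairs (by omega) hrk' (by omega), ← hε, ← hpre]
  exact ncard_fullRankPairs_inter_pairsMatching hi hr q fun p hp hab =>
    joinRank_restrict_of_closed hi hr _ (fun _ => epsNK_apply_of_lt ha)
      (fun _ => epsNK_apply_of_lt hb) hp hab

/-- Removing `a` and `b`, where `b` lies in a doubleton `ε`-class. -/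
theorem ncard_inter_pairsMatching_of_le (q : ℕ) (hrk : r ≤ k) (hkn : k ≤ n)
    (hpar : n % 2 = k % 2) {a b : Fin n} (ha : a.val < r) (hb : k ≤ b.val) :
    (fullRankPairs (epsNK n k) (domSet n r) q ∩ pairsMatching a b).ncard = mu (n - 2) k r q := by
  obtain ⟨c, hck, hcb, hc⟩ := exists_partner_epsNK hpar hb
  have hab : a ≠ b := fun h => by rw [h] at ha; omega
  have hac : a ≠ c := fun h => by rw [h] at ha; omega
  have hcU : c ∈ ({a, b}ᶜ : Set (Fin n)) := by
    rintro (h | h)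
    exacts [hac h.symm, hcb h]
  have hcard : ∀ s, s ≤ k → a.val < s →
      (insert c ({x : Fin n | x.val < s} \ {a})).ncard = s := by
    intro s hs has
    have h := Set.ncard_sdiff_singleton_add_one (s := {x : Fin n | x.val < s}) (a := a) has
      (Set.toFinite _)
    rw [Set.ncard_insert_of_notMem _ (Set.toFinite _), h, ncard_setOf_val_lt (hs.trans hkn)]
    rintro ⟨h, -⟩
    have : c.val < s := h
    omega
  have hU := Set.ncard_add_ncard_compl ({a, b} : Set (Fin n)) (Set.toFinite _) (Set.toFinite _)
  rw [Nat.card_eq_fintype_card, Fintype.card_fin, Set.ncard_pair hab] at hU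
  obtain ⟨i, hi, hr, hε, hD⟩ := exists_embedding_epsNK (epsNK n k) (U := {a, b}ᶜ)
    (D := insert c (domSet n r \ {a}))
    (Z := insert c ({x | x.val < k} \ {a})) (n := n - 2) (k := k) (r := r)
    (Set.insert_subset_insert
      (Set.sdiff_subset_sdiff_left fun x (hx : x.val < r) => (by omega : x.val < k)))
    (by
      rintro x (rfl | ⟨h, hxa⟩)
      · exact hcU
      · have : x.val < k := h
        rintro (h' | rfl)
        · exact hxa h'
        · omega)
    (by
      rintro x (rfl | ⟨h, -⟩) y hyU hxy
      · refine ((hc y).1 ((epsNK n k).trans ((hc x).2 (Or.inr rfl)) hxy)).resolve_left ?_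
        exact fun h => hyU (Or.inr h)
      · exact epsNK_apply_of_lt h hxy)
    (by
      rintro x ⟨hxU, hxZ⟩
      have hxa : x ≠ a := fun h => hxU (Or.inl h)
      have hxb : x ≠ b := fun h => hxU (Or.inr h)
      have hxc : x ≠ c := fun h => hxZ (Or.inl h)
      have hxk : k ≤ x.val := by
        by_contra hxk
        exact hxZ (Or.inr ⟨not_le.1 hxk, hxa⟩)
      obtain ⟨d, hdk, hdx, hd⟩ := exists_partner_epsNK hpar hxk
      refine ⟨d, ?_, hdx, fun y _ => hd y⟩
      rintro (rfl | rfl)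
      · omega
      · have := (hc x).1 ((epsNK n k).symm ((hd d).2 (Or.inr rfl)))
        exact this.elim hxb hxc)
    (by omega) (hcard k le_rfl (by omega)) (hcard r hrk ha)
  obtain ⟨c', rfl⟩ : c ∈ Set.range i := hr ▸ hcU
  have hpre : insert c' (i ⁻¹' domSet n r) = domSet (n - 2) r := by
    rw [← hD]
    ext x
    simp only [Set.mem_insert_iff, Set.mem_preimage, hi.eq_iff]
    refine or_congr_right ⟨fun h => ⟨h, ?_⟩, fun h => h.1⟩
    have : i x ∈ Set.range i := ⟨x, rfl⟩
    rw [hr] at this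
    exact fun h => this (Or.inl h)
  have hbn := b.isLt
  have hkn' : k ≤ n - 2 := by omega
  rw [mu_eq_ncard_fullRankPairs hkn' hrk (by omega), ← hε, ← hpre]
  refine ncard_fullRankPairs_inter_pairsMatching hi hr q fun p hp hab =>
    joinRank_restrict_of_contract hi hr ?_ ha hc hp hab
  exact fun d (hd : d.val < r) y => epsNK_apply_of_lt (by omega)

end EpsNK

/-- The recurrence for `μ`: for `n ≥ k ≥ r ≥ q > 0` with `n ≡ k (mod 2)`,
`μ(n,k,r,q) = (n−k)·μ(n−2,k,r,q) + μ(n−1,k−1,r−1,q−1) + μ(n−1,k−1,r−1,q)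
 + (k−r)·μ(n−2,k−2,r−1,q) + (r−1)·μ(n−2,k−2,r−2,q)`. -/
theorem mu_recurrence (n k r q : ℕ) (hq : 0 < q) (hqr : q ≤ r) (hrk : r ≤ k)
    (hkn : k ≤ n) (hpar : n % 2 = k % 2) :
    mu n k r q =
      (n - k) * mu (n - 2) k r q + mu (n - 1) (k - 1) (r - 1) (q - 1) +
        mu (n - 1) (k - 1) (r - 1) q + (k - r) * mu (n - 2) (k - 2) (r - 1) q +
        (r - 1) * mu (n - 2) (k - 2) (r - 2) q := by

  let a : Fin n := ⟨r - 1, by omega⟩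
  have har : a.val < r := by change r - 1 < r; omega
  have hak : a.val < k := by omega
  have hdom : ∀ s : Set (Fin n), s ⊆ domSet n r → (domSet n r \ s).ncard = r - s.ncard := by
    intro s hs
    have h := Set.ncard_sdiff_add_ncard_of_subset hs (Set.toFinite _)
    have h' : (domSet n r).ncard = r := ncard_setOf_val_lt (hrk.trans hkn)
    omega
  have hsingle : ∀ q, (fullRankPairs (epsNK n k) (domSet n r) q ∩ pairsMatching a a).ncard =
      mu (n - 1) (k - 1) (r - 1) q := by
    intro q
    have h1 : ({a, a} : Set (Fin n)).ncard = 1 := by simp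
    refine ncard_inter_pairsMatching_of_lt q hrk hkn hpar hak hak (by omega) (by omega) ?_
    rw [hdom _ (by rintro x (rfl | rfl) <;> exact har), h1]
  let g : ℕ → ℕ := fun j =>
    if j < r - 1 then mu (n - 2) (k - 2) (r - 2) q
    else if j = r - 1 then mu (n - 1) (k - 1) (r - 1) q
    else if j < k then mu (n - 2) (k - 2) (r - 1) q
    else mu (n - 2) k r q
  have hg : ∀ b : Fin n,
      (fullRankPairs (epsNK n k) (domSet n r) q ∩ pairsMatching a b).ncard = g b := by
    intro b
    simp only [g]
    split_ifs with h1 h2 h3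
    · have hab : a ≠ b := fun h => by rw [← h] at h1; exact lt_irrefl _ h1
      have hc := Set.ncard_pair hab
      refine ncard_inter_pairsMatching_of_lt q hrk hkn hpar hak (by omega) (by omega)
        (by omega) ?_
      rw [hdom _ ?_, hc]
      rintro x (rfl | rfl)
      · exact har
      · exact h1.trans (by omega)
    · rw [show b = a from Fin.ext h2]
      exact hsingle q
    · have hab : a ≠ b := fun h => by rw [← h] at h2; exact h2 rfl
      have hc := Set.ncard_pair hab
      refine ncard_inter_pairsMatching_of_lt q hrk hkn hpar hak h3 (by omega) (by omega) ?_
      rw [show domSet n r \ {a, b} = domSet n r \ {a} from ?_, hdom _ ?_, Set.ncard_singleton]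
      · rintro x rfl
        exact har
      · ext x
        refine ⟨fun h => ⟨h.1, fun h' => h.2 (Or.inl h')⟩, fun h => ⟨h.1, ?_⟩⟩
        rintro (h' | rfl)
        · exact h.2 h'
        · have : x.val < r := h.1
          omega
    · exact ncard_inter_pairsMatching_of_le q hrk hkn hpar har (by omega)
  rw [mu_eq_ncard_fullRankPairs hkn hrk hpar,
    ncard_fullRankPairs_eq_sum (a := a) har (fun _ => epsNK_apply_of_lt hak) hq, hsingle,
    Finset.sum_congr rfl fun b _ => hg b, Fin.sum_univ_eq_sum_range,
    show n = r - 1 + 1 + (k - r) + (n - k) by omega, Finset.sum_range_add, Finset.sum_range_add,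
    Finset.sum_range_succ, ← show n = r - 1 + 1 + (k - r) + (n - k) by omega]
  have s1 : ∑ x ∈ Finset.range (r - 1), g x = (r - 1) * mu (n - 2) (k - 2) (r - 2) q := by
    rw [Finset.sum_congr rfl fun x hx => if_pos (Finset.mem_range.1 hx)]
    simp
  have s2 : g (r - 1) = mu (n - 1) (k - 1) (r - 1) q := by simp [g]
  have s3 : ∑ x ∈ Finset.range (k - r), g (r - 1 + 1 + x) =
      (k - r) * mu (n - 2) (k - 2) (r - 1) q := by
    rw [Finset.sum_congr rfl (g := fun _ => mu (n - 2) (k - 2) (r - 1) q) fun x hx => ?_]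
    · simp
    · have := Finset.mem_range.1 hx
      simp only [g]
      rw [if_neg (by omega), if_neg (by omega), if_pos (by omega)]
  have s4 : ∑ x ∈ Finset.range (n - k), g (r - 1 + 1 + (k - r) + x) =
      (n - k) * mu (n - 2) k r q := by
    rw [Finset.sum_congr rfl (g := fun _ => mu (n - 2) k r q) fun x hx => ?_]
    · simp
    · simp only [g]
      rw [if_neg (by omega), if_neg (by omega), if_neg (by omega)]
  rw [s1, s2, s3, s4]
  ring
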